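/- For all integers n, k ≥ 0: if n ≡ 2k (mod 3), say n = 2k + 3m with m an integer, then a(n,k) = binom(n+1, m) - 3·binom(n, m-1) (with the convention that binom(p, q) = 0 whenever q < 0, and where a(n,k)=0 if n < 2k); if n ≢ 2k (mod 3), then a(n,k) = 0. -/

import Mathlib

/- `a n k` and `b n k` satisfy `a n k = b (n-1) (k-1) + a (n-1) (k+1)` and
`b n k = a (n-1) k + b (n-1) (k+1)`, where a term with second index `-1` is
interpreted as `0`, with initial values `a 0 0 = 1`, `b 0 0 = 0` and
`a 0 k = b 0 k = 0` for `k ≥ 1`. -/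
mutual
  def a : ℕ → ℕ → ℕ
    | 0, 0 => 1
    | 0, _ + 1 => 0
    | n + 1, 0 => a n 1
    | n + 1, k + 1 => b n k + a n (k + 2)
  def b : ℕ → ℕ → ℕ
    | 0, _ => 0
    | n + 1, k => a n k + b n (k + 1)
end

/-- The binomial coefficient `binom p q` for natural `p` and integer `q`, with the
convention that it vanishes when `q < 0`. -/
def choInt (p : ℕ) (q : ℤ) : ℤ :=
  if q < 0 then 0 else Nat.choose p q.toNat

theorem choInt_of_neg (p : ℕ) {q : ℤ} (hq : q < 0) : choInt p q = 0 := if_pos hq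

theorem choInt_natCast (p q : ℕ) : choInt p q = p.choose q := by
  simp [choInt]

theorem choInt_succ (p : ℕ) (q : ℤ) :
    choInt (p + 1) q = choInt p q + choInt p (q - 1) := by
  rcases lt_or_ge q 0 with hq | hq
  · rw [choInt_of_neg _ hq, choInt_of_neg _ hq, choInt_of_neg _ (by lia), add_zero]
  · lift q to ℕ using hq
    cases q with
    | zero => simp [choInt]
    | succ q =>
      have h : ((q + 1 : ℕ) : ℤ) - 1 = q := by push_cast; ring
      rw [h, choInt_natCast, choInt_natCast, choInt_natCast, Nat.choose_succ_succ]
      push_cast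
      ring

/-- The absorption identity `m * binom (3 m) m = 3 m * binom (3 m - 1) (m - 1)`, divided by `m`. -/
theorem choInt_succ_eq_three_mul {n : ℕ} {m : ℤ} (h : (n : ℤ) + 1 = 3 * m) :
    choInt (n + 1) m = 3 * choInt n (m - 1) := by
  lift m to ℕ using by lia
  obtain ⟨q, rfl⟩ : ∃ q, m = q + 1 := ⟨m - 1, by lia⟩
  have hq : ((q + 1 : ℕ) : ℤ) - 1 = q := by push_cast; ring
  rw [hq, choInt_natCast, choInt_natCast]
  have key := Nat.add_one_mul_choose_eq n q
  have hn : n + 1 = 3 * (q + 1) := by lia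
  have hc : (n + 1).choose (q + 1) = 3 * n.choose q := by
    apply Nat.eq_of_mul_eq_mul_right q.add_one_pos
    rw [← key, hn]
    ring
  exact_mod_cast hc

theorem a_eq_zero_and_b_eq_zero (n : ℕ) :
    ∀ k, ((n + k) % 3 ≠ 0 → a n k = 0) ∧ ((n + k) % 3 ≠ 1 → b n k = 0) := by
  induction n with
  | zero =>
    rintro (_ | k) <;> simp [a, b]
  | succ n ih =>
    refine fun k => ⟨fun h => ?_, fun h => ?_⟩
    · cases k with
      | zero => rw [a, (ih 1).1 (by lia)]
      | succ k => rw [a, (ih k).2 (by lia), (ih (k + 2)).1 (by lia)]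
    · rw [b, (ih k).1 (by lia), (ih (k + 1)).2 (by lia)]

theorem a_eq_and_b_eq (n : ℕ) :
    ∀ (k : ℕ) (m : ℤ),
      ((n : ℤ) = 2 * k + 3 * m →
        (a n k : ℤ) = choInt (n + 1) m - 3 * choInt n (m - 1)) ∧
      ((n : ℤ) = 2 * k + 1 + 3 * m →
        (b n k : ℤ) = choInt (n + 1) m - 3 * choInt n (m - 1)) := by
  induction n with
  | zero =>
    refine fun k m => ⟨fun h => ?_, fun h => ?_⟩
    · cases k with
      | zero =>
        obtain rfl : m = 0 := by lia
        simp [a, choInt]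
      | succ k =>
        rw [a, choInt_of_neg _ (by lia), choInt_of_neg _ (by lia)]
        simp
    · rw [b, choInt_of_neg _ (by lia), choInt_of_neg _ (by lia)]
      simp
  | succ n ih =>
    refine fun k m => ⟨fun h => ?_, fun h => ?_⟩
    · cases k with
      | zero =>
        rw [a, (ih 1 (m - 1)).1 (by lia)]
        have h₀ := choInt_succ_eq_three_mul (n := n) (m := m) (by lia)
        linarith [choInt_succ (n + 1) m, choInt_succ n (m - 1)]
      | succ k =>
        rw [a, Nat.cast_add, (ih k m).2 (by lia), (ih (k + 2) (m - 1)).1 (by lia)]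
        linarith [choInt_succ (n + 1) m, choInt_succ n (m - 1)]
    · rw [b, Nat.cast_add, (ih k m).1 (by lia), (ih (k + 1) (m - 1)).2 (by lia)]
      linarith [choInt_succ (n + 1) m, choInt_succ n (m - 1)]

theorem a_closed_form (n k : ℕ) :
    (Int.ModEq 3 (n : ℤ) (2 * k) →
      ∀ m : ℤ, (n : ℤ) = 2 * k + 3 * m →
        (a n k : ℤ) = choInt (n + 1) m - 3 * choInt n (m - 1)) ∧
    (¬ Int.ModEq 3 (n : ℤ) (2 * k) → a n k = 0) := by
  refine ⟨fun _ m h => (a_eq_and_b_eq n k m).1 h,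
    fun h => (a_eq_zero_and_b_eq_zero n k).1 fun h₀ => h ?_⟩
  unfold Int.ModEq
  lia
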